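/- arXiv:1506.00510 — 3 statements merged into one kernel-verified Lean document; each statement's English description precedes it below -/
import Mathlib

section
/- Fix an integer k ≥ 2 and for m ∈ ℕ define F(m) = Σ_{p=0}^{⌊(m−2)/2⌋} C(2p+k, k−1) · Σ_{q=0}^{⌊(m−2p−1)/2⌋} ((m−2p−2q)/(k−1)) · C(m−2p−q+k−2, k−2) · C(q+k−2, k−2), where C(a,b) denotes the binomial coefficient and the value is taken in ℝ. Then F grows exactly of degree 3k−2: there exist real constants c₁, c₂ > 0 and N such that c₁·m^{3k−2} ≤ F(m) ≤ c₂·m^{3k−2} for all m ≥ N. -/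
/-- `F k m = ∑_{p=0}^{⌊(m−2)/2⌋} C(2p+k, k−1) ·
∑_{q=0}^{⌊(m−2p−1)/2⌋} ((m−2p−2q)/(k−1)) · C(m−2p−q+k−2, k−2) · C(q+k−2, k−2)`,
the value taken in `ℝ`. (The index `p` runs over the naturals with `2p + 2 ≤ m`, i.e.
`0 ≤ p ≤ ⌊(m−2)/2⌋`, and `q` over those with `2p + 2q + 1 ≤ m`, i.e.
`0 ≤ q ≤ ⌊(m−2p−1)/2⌋`; empty ranges give `0`.) -/
noncomputable def combF (k m : ℕ) : ℝ :=
  ∑ p ∈ Finset.range m,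
    if 2 * p + 2 ≤ m then
      (Nat.choose (2 * p + k) (k - 1) : ℝ) *
        ∑ q ∈ Finset.range m,
          if 2 * p + 2 * q + 1 ≤ m then
            (((m : ℝ) - 2 * p - 2 * q) / ((k : ℝ) - 1)) *
              (Nat.choose (m - 2 * p - q + k - 2) (k - 2) : ℝ) *
              (Nat.choose (q + k - 2) (k - 2) : ℝ)
          else 0
    else 0

open Nat in
theorem pow_div_factorial_le_choose_add (j a b : ℕ) (h : a + j ≤ b) :
    (a : ℝ) ^ j / (j ! : ℝ) ≤ (b.choose j : ℝ) := by
  refine le_trans ?_ (Nat.pow_le_choose j b)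
  gcongr
  omega

theorem choose_le_pow_of_le (j a b : ℕ) (h : b ≤ a) : (b.choose j : ℝ) ≤ (a : ℝ) ^ j := by
  exact_mod_cast (Nat.choose_le_pow b j).trans (Nat.pow_le_pow_left h j)

theorem combF_inner_nonneg (j m p q : ℕ) :
    0 ≤ if 2 * p + 2 * q + 1 ≤ m then
            (((m : ℝ) - 2 * p - 2 * q) / (((j + 2 : ℕ) : ℝ) - 1)) *
              (Nat.choose (m - 2 * p - q + (j + 2) - 2) (j + 2 - 2) : ℝ) *
              (Nat.choose (q + (j + 2) - 2) (j + 2 - 2) : ℝ)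
          else 0 := by
  split_ifs with h
  · have h' : (2 * p + 2 * q + 1 : ℝ) ≤ m := mod_cast h
    have : 0 ≤ (m : ℝ) - 2 * p - 2 * q := by linarith
    have : 0 ≤ (((j + 2 : ℕ) : ℝ) - 1) := by push_cast; linarith [j.cast_nonneg (α := ℝ)]
    positivity
  · exact le_rfl

theorem combF_le (j m : ℕ) (hm : j + 2 ≤ m) :
    combF (j + 2) m ≤ 2 ^ (3 * j + 1) * (m : ℝ) ^ (3 * j + 4) := by
  have key : ∀ p ∈ Finset.range m, (if 2 * p + 2 ≤ m then
      (Nat.choose (2 * p + (j + 2)) (j + 2 - 1) : ℝ) *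
        ∑ q ∈ Finset.range m,
          if 2 * p + 2 * q + 1 ≤ m then
            (((m : ℝ) - 2 * p - 2 * q) / (((j + 2 : ℕ) : ℝ) - 1)) *
              (Nat.choose (m - 2 * p - q + (j + 2) - 2) (j + 2 - 2) : ℝ) *
              (Nat.choose (q + (j + 2) - 2) (j + 2 - 2) : ℝ)
          else 0
    else 0) ≤ ((2 * m : ℕ) : ℝ) ^ (j + 1) *
      (m * (m * ((2 * m : ℕ) : ℝ) ^ j * ((2 * m : ℕ) : ℝ) ^ j)) := by
    intro p _
    split_ifs with h
    · gcongr
      · exact Finset.sum_nonneg fun q _ => combF_inner_nonneg j m p q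
      · exact choose_le_pow_of_le _ _ _ (by omega)
      · rw [← nsmul_eq_mul]
        refine (Finset.sum_le_card_nsmul _ _
          (m * ((2 * m : ℕ) : ℝ) ^ j * ((2 * m : ℕ) : ℝ) ^ j) fun q _ => ?_).trans_eq
          (by rw [Finset.card_range])
        split_ifs with hq
        · have hj : (0 : ℝ) ≤ j := j.cast_nonneg
          have hp : (0 : ℝ) ≤ p := p.cast_nonneg
          have hq0 : (0 : ℝ) ≤ q := q.cast_nonneg
          have hm0 : (0 : ℝ) ≤ m := m.cast_nonneg
          gcongr
          · rw [div_le_iff₀ (by push_cast; linarith)]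
            push_cast
            nlinarith [mul_nonneg hm0 hj]
          · exact choose_le_pow_of_le _ _ _ (by omega)
          · exact choose_le_pow_of_le _ _ _ (by omega)
        · positivity
    · positivity
  refine (Finset.sum_le_card_nsmul _ _ _ key).trans_eq ?_
  rw [Finset.card_range, nsmul_eq_mul]
  push_cast
  ring

open Nat in
theorem le_combF (j m n : ℕ) (hn : 1 ≤ n) (hm : 16 * n ≤ m) :
    (n : ℝ) ^ (3 * j + 4) / ((j + 1)! * (j + 1) * j ! * j !) ≤ combF (j + 2) m := by
  have hsub : Finset.Ico n (2 * n) ⊆ Finset.range m := fun x hx => by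
    simp only [Finset.mem_Ico, Finset.mem_range] at *
    omega
  have hcard : (Finset.Ico n (2 * n)).card = n := by simp; omega
  have inner : ∀ p ∈ Finset.Ico n (2 * n), (n : ℝ) * (n / (j + 1) * (n ^ j / j !) * (n ^ j / j !)) ≤
      ∑ q ∈ Finset.range m,
          if 2 * p + 2 * q + 1 ≤ m then
            (((m : ℝ) - 2 * p - 2 * q) / (((j + 2 : ℕ) : ℝ) - 1)) *
              (Nat.choose (m - 2 * p - q + (j + 2) - 2) (j + 2 - 2) : ℝ) *
              (Nat.choose (q + (j + 2) - 2) (j + 2 - 2) : ℝ)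
          else 0 := by
    intro p hp
    refine le_trans ?_ (Finset.sum_le_sum_of_subset_of_nonneg hsub
      fun q _ _ => combF_inner_nonneg j m p q)
    rw [← nsmul_eq_mul]
    refine le_trans (by rw [hcard]) (Finset.card_nsmul_le_sum (Finset.Ico n (2 * n)) _
      (n / (j + 1) * (n ^ j / j !) * (n ^ j / j !) : ℝ) fun q hq => ?_)
    rw [Finset.mem_Ico] at hp hq
    rw [if_pos (by omega)]
    have hle : (n + 2 * p + 2 * q : ℝ) ≤ m := by
      have : n + 2 * p + 2 * q ≤ m := by omega
      exact_mod_cast this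
    have hfrac : (n / (j + 1) : ℝ) ≤ ((m : ℝ) - 2 * p - 2 * q) / (((j + 2 : ℕ) : ℝ) - 1) := by
      have : ((j + 2 : ℕ) : ℝ) - 1 = j + 1 := by push_cast; ring
      rw [this]
      gcongr
      linarith
    have hfrac0 := le_trans (by positivity) hfrac
    gcongr
    · exact pow_div_factorial_le_choose_add _ _ _ (by omega)
    · exact pow_div_factorial_le_choose_add _ _ _ (by omega)
  have outer : (n : ℝ) * (n ^ (j + 1) / (j + 1)! *
      (n * (n / (j + 1) * (n ^ j / j !) * (n ^ j / j !)))) ≤ combF (j + 2) m := by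
    refine le_trans ?_ (Finset.sum_le_sum_of_subset_of_nonneg hsub fun p _ _ => ?_)
    · rw [← nsmul_eq_mul]
      refine le_trans (by rw [hcard]) (Finset.card_nsmul_le_sum (Finset.Ico n (2 * n)) _
        (n ^ (j + 1) / (j + 1)! * (n * (n / (j + 1) * (n ^ j / j !) * (n ^ j / j !))) : ℝ)
        fun p hp => ?_)
      have := inner p hp
      rw [Finset.mem_Ico] at hp
      rw [if_pos (by omega)]
      gcongr
      exact pow_div_factorial_le_choose_add _ _ _ (by omega)
    · split_ifs
      · exact mul_nonneg (Nat.cast_nonneg _)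
          (Finset.sum_nonneg fun q _ => combF_inner_nonneg j m p q)
      · exact le_rfl
  refine le_trans (le_of_eq ?_) outer
  field_simp
  ring

/-- for `k ≥ 2`, the function `F` grows exactly of degree `3k − 2`. -/
theorem combF_growth (k : ℕ) (hk : 2 ≤ k) :
    ∃ c₁ c₂ : ℝ, 0 < c₁ ∧ 0 < c₂ ∧ ∃ N : ℕ, ∀ m : ℕ, N ≤ m →
      c₁ * (m : ℝ) ^ (3 * k - 2) ≤ combF k m ∧
      combF k m ≤ c₂ * (m : ℝ) ^ (3 * k - 2) := by
  obtain ⟨j, rfl⟩ : ∃ j, k = j + 2 := ⟨k - 2, by omega⟩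
  rw [show 3 * (j + 2) - 2 = 3 * j + 4 by omega]
  refine ⟨(1 / 32) ^ (3 * j + 4) / ((j + 1).factorial * (j + 1) * j.factorial * j.factorial), 2 ^ (3 * j + 1),
    by positivity, by positivity, j + 16, fun m hm => ⟨?_, combF_le j m (by omega)⟩⟩
  refine le_trans ?_ (le_combF j m (m / 16) (by omega) (by omega))
  rw [div_mul_eq_mul_div, ← mul_pow]
  gcongr
  have : m ≤ 32 * (m / 16) := by omega
  have : (m : ℝ) ≤ 32 * ((m / 16 : ℕ) : ℝ) := mod_cast this
  linarith
end

section
/- Fix an integer k ≥ 2 and for m ∈ ℕ define G(m) = Σ_{s=0}^{⌊(m−1)/2⌋} Σ_{t=0}^{⌊(m−2s−1)/2⌋} Σ_{u=0}^{⌊(m−2s−2t−2)/2⌋} C(2s+k−1, k−1) · C(2t+k, k−1) · C(2u+k, k−1). Then G grows exactly of degree 3k: there exist real constants c₁, c₂ > 0 and N such that c₁·m^{3k} ≤ G(m) ≤ c₂·m^{3k} for all m ≥ N. -/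
/-- `G k m = ∑_{s=0}^{⌊(m−1)/2⌋} ∑_{t=0}^{⌊(m−2s−1)/2⌋} ∑_{u=0}^{⌊(m−2s−2t−2)/2⌋}
C(2s+k−1, k−1) · C(2t+k, k−1) · C(2u+k, k−1)`, the value taken in `ℝ`. (The index `s` runs
over the naturals with `2s + 1 ≤ m`, `t` over those with `2s + 2t + 1 ≤ m`, and `u` over
those with `2s + 2t + 2u + 2 ≤ m`; empty ranges give `0`.) -/
noncomputable def combG (k m : ℕ) : ℝ :=
  ∑ s ∈ Finset.range m,
    ∑ t ∈ Finset.range m,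
      ∑ u ∈ Finset.range m,
        if 2 * s + 1 ≤ m ∧ 2 * s + 2 * t + 1 ≤ m ∧ 2 * s + 2 * t + 2 * u + 2 ≤ m then
          (Nat.choose (2 * s + k - 1) (k - 1) : ℝ) *
            (Nat.choose (2 * t + k) (k - 1) : ℝ) *
            (Nat.choose (2 * u + k) (k - 1) : ℝ)
        else 0

/-- If `q ≤ n + 1 - r`, then `C(n, r)` is at least `q ^ r / r!`. -/
theorem pow_div_factorial_le_choose {q n r : ℕ} (h : q + r ≤ n + 1) :
    (q : ℝ) ^ r / (r.factorial : ℝ) ≤ (n.choose r : ℝ) := by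
  have hq : q ≤ n + 1 - r := by omega
  calc (q : ℝ) ^ r / (r.factorial : ℝ)
      ≤ ((n + 1 - r : ℕ) : ℝ) ^ r / (r.factorial : ℝ) := by gcongr
    _ ≤ (n.choose r : ℝ) := Nat.pow_le_choose r n

theorem choose_le_pow_of_le_s15 {n b r : ℕ} (h : n ≤ b) : (n.choose r : ℝ) ≤ (b : ℝ) ^ r := by
  exact_mod_cast (Nat.choose_le_pow n r).trans (Nat.pow_le_pow_left h r)

theorem combG_le {k m : ℕ} (hkm : k ≤ m) :
    combG k m ≤ (m : ℝ) ^ 3 * (((2 * m : ℕ) : ℝ) ^ (k - 1)) ^ 3 := by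
  set B : ℝ := ((2 * m : ℕ) : ℝ) ^ (k - 1)
  have hB0 : 0 ≤ B := by positivity
  have hterm : combG k m ≤ ∑ _s ∈ Finset.range m, ∑ _t ∈ Finset.range m,
      ∑ _u ∈ Finset.range m, B * B * B := by
    refine Finset.sum_le_sum fun s _ => Finset.sum_le_sum fun t _ =>
      Finset.sum_le_sum fun u _ => ?_
    split_ifs with h
    · gcongr <;> exact choose_le_pow_of_le_s15 (by omega)
    · positivity
  refine hterm.trans_eq ?_
  simp only [Finset.sum_const, Finset.card_range, nsmul_eq_mul]
  ring

theorem le_combG {k m q : ℕ} (hk : 1 ≤ k) (hq : 12 * q ≤ m) :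
    (q : ℝ) ^ 3 * ((q : ℝ) ^ (k - 1) / ((k - 1).factorial : ℝ)) ^ 3 ≤ combG k m := by
  set A : ℝ := (q : ℝ) ^ (k - 1) / ((k - 1).factorial : ℝ)
  have hA0 : 0 ≤ A := by positivity
  have hsub : Finset.Ico q (2 * q) ⊆ Finset.range m := fun x hx => by
    simp only [Finset.mem_Ico, Finset.mem_range] at hx ⊢
    omega
  have hnonneg : ∀ s t u : ℕ, (0 : ℝ) ≤
      if 2 * s + 1 ≤ m ∧ 2 * s + 2 * t + 1 ≤ m ∧ 2 * s + 2 * t + 2 * u + 2 ≤ m then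
        (Nat.choose (2 * s + k - 1) (k - 1) : ℝ) * (Nat.choose (2 * t + k) (k - 1) : ℝ) *
          (Nat.choose (2 * u + k) (k - 1) : ℝ)
      else 0 := fun s t u => by split_ifs <;> positivity
  have hsum : ∑ _s ∈ Finset.Ico q (2 * q), ∑ _t ∈ Finset.Ico q (2 * q),
      ∑ _u ∈ Finset.Ico q (2 * q), A * A * A ≤ combG k m := by
    refine (Finset.sum_le_sum fun s hs => ?_).trans
      (Finset.sum_le_sum_of_subset_of_nonneg hsub fun s _ _ =>
        Finset.sum_nonneg fun t _ => Finset.sum_nonneg fun u _ => hnonneg s t u)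
    refine (Finset.sum_le_sum fun t ht => ?_).trans
      (Finset.sum_le_sum_of_subset_of_nonneg hsub fun t _ _ =>
        Finset.sum_nonneg fun u _ => hnonneg s t u)
    refine (Finset.sum_le_sum fun u hu => ?_).trans
      (Finset.sum_le_sum_of_subset_of_nonneg hsub fun u _ _ => hnonneg s t u)
    rw [Finset.mem_Ico] at hs ht hu
    rw [if_pos (by omega)]
    gcongr <;> exact pow_div_factorial_le_choose (by omega)
  refine le_trans (le_of_eq ?_) hsum
  simp only [Finset.sum_const, Nat.card_Ico, nsmul_eq_mul]
  rw [show 2 * q - q = q by omega]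
  ring

/-- for `k ≥ 2`, the function `G` grows exactly of degree `3k`. -/
theorem combG_growth (k : ℕ) (hk : 2 ≤ k) :
    ∃ c₁ c₂ : ℝ, 0 < c₁ ∧ 0 < c₂ ∧ ∃ N : ℕ, ∀ m : ℕ, N ≤ m →
      c₁ * (m : ℝ) ^ (3 * k) ≤ combG k m ∧
      combG k m ≤ c₂ * (m : ℝ) ^ (3 * k) := by
  refine ⟨(1 / 24) ^ (3 * k) / ((k - 1).factorial : ℝ) ^ 3, (2 ^ (k - 1)) ^ 3,
    by positivity, by positivity, max 12 k, fun m hm => ?_⟩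
  have hpow : ∀ x : ℝ, x ^ 3 * (x ^ (k - 1)) ^ 3 = x ^ (3 * k) := fun x => by
    rw [← pow_mul, ← pow_add]
    congr 1
    omega
  constructor
  · have hq : (m : ℝ) ≤ 24 * (m / 12 : ℕ) := by
      exact_mod_cast (by omega : m ≤ 24 * (m / 12))
    refine le_trans ?_ (le_combG (by omega) (Nat.mul_div_le m 12))
    rw [div_pow (_ ^ (k - 1)), mul_div_assoc', hpow, div_mul_eq_mul_div, ← mul_pow]
    gcongr
    linarith
  · refine (combG_le (by omega)).trans_eq ?_
    rw [← hpow]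
    push_cast
    ring
end

section
/- Fix an integer k ≥ 2 and for even m ∈ ℕ define H(m) = Σ_{s=0}^{(m−2)/2} C((m−2s)/2 + k−1, k−1)² · C(2s+k−1, k−1). Then H grows exactly of degree 3k−2 along even integers: there exist real constants c₁, c₂ > 0 and N such that c₁·m^{3k−2} ≤ H(m) ≤ c₂·m^{3k−2} for all even m ≥ N. -/
/-- `H k m = ∑_{s=0}^{(m−2)/2} C((m−2s)/2 + k−1, k−1)² · C(2s+k−1, k−1)`, the value taken
in `ℝ` (intended for even `m`; the index `s` runs over the naturals with `2s + 2 ≤ m`, i.e.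
`0 ≤ s ≤ (m−2)/2`; empty ranges give `0`). -/
noncomputable def combH (k m : ℕ) : ℝ :=
  ∑ s ∈ Finset.range m,
    if 2 * s + 2 ≤ m then
      (Nat.choose ((m - 2 * s) / 2 + k - 1) (k - 1) : ℝ) ^ 2 *
        (Nat.choose (2 * s + k - 1) (k - 1) : ℝ)
    else 0

theorem pow_div_factorial_le_choose_add_s16 {r p : ℕ} (hrp : r ≤ p) (d : ℕ) :
    (r : ℝ) ^ d / (d.factorial : ℝ) ≤ ((p + d).choose d : ℝ) := by
  have h1 : (p + 1) ^ d ≤ (p + d).descFactorial d := by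
    have h := Nat.pow_sub_le_descFactorial (p + d) d
    rwa [show p + d + 1 - d = p + 1 by omega] at h
  rw [Nat.descFactorial_eq_factorial_mul_choose] at h1
  have h2 : r ^ d ≤ d.factorial * (p + d).choose d :=
    (Nat.pow_le_pow_left (by omega) d).trans h1
  rw [div_le_iff₀' (by positivity)]
  exact_mod_cast h2

theorem combH_le (d m : ℕ) (hm : d ≤ m) :
    combH (d + 1) m ≤ 2 ^ (3 * d) * (m : ℝ) ^ (3 * d + 1) := by
  have choose_le : ∀ p ≤ m, ((p + d).choose d : ℝ) ≤ (2 * m) ^ d := fun p hp => by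
    have h : (p + d).choose d ≤ (2 * m) ^ d :=
      (Nat.choose_le_pow _ _).trans (Nat.pow_le_pow_left (by omega) d)
    exact_mod_cast h
  have term_le : ∀ s ∈ Finset.range m,
      (if 2 * s + 2 ≤ m then
        (Nat.choose ((m - 2 * s) / 2 + d) d : ℝ) ^ 2 * (Nat.choose (2 * s + d) d : ℝ)
      else 0) ≤ ((2 * m : ℝ) ^ d) ^ 2 * (2 * m) ^ d := fun s _ => by
    split_ifs with hs
    · have h1 := choose_le ((m - 2 * s) / 2) (by omega)
      have h2 := choose_le (2 * s) (by omega)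
      gcongr
    · positivity
  calc combH (d + 1) m ≤ m • (((2 * m : ℝ) ^ d) ^ 2 * (2 * m) ^ d) := by
        simpa [combH] using Finset.sum_le_card_nsmul _ _ _ term_le
    _ = 2 ^ (3 * d) * (m : ℝ) ^ (3 * d + 1) := by
        rw [nsmul_eq_mul]; ring

theorem le_combH (d m : ℕ) (hm : 8 ≤ m) :
    1 / (16 ^ (3 * d + 1) * (d.factorial : ℝ) ^ 3) * (m : ℝ) ^ (3 * d + 1) ≤
      combH (d + 1) m := by
  obtain ⟨r, hr⟩ : ∃ r, r = m / 8 := ⟨_, rfl⟩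
  have hmr : (m : ℝ) / 16 ≤ r := by
    have h : m ≤ 16 * r := by omega
    have h' : (m : ℝ) ≤ 16 * r := by exact_mod_cast h
    linarith
  have le_term : ∀ s ∈ Finset.Ico r (2 * r),
      ((r : ℝ) ^ d / (d.factorial : ℝ)) ^ 2 * ((r : ℝ) ^ d / (d.factorial : ℝ)) ≤
      (if 2 * s + 2 ≤ m then
        (Nat.choose ((m - 2 * s) / 2 + d) d : ℝ) ^ 2 * (Nat.choose (2 * s + d) d : ℝ)
      else 0) := fun s hs => by
    rw [Finset.mem_Ico] at hs
    rw [if_pos (by omega)]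
    have h1 := pow_div_factorial_le_choose_add_s16 (r := r) (p := (m - 2 * s) / 2) (by omega) d
    have h2 := pow_div_factorial_le_choose_add_s16 (r := r) (p := 2 * s) (by omega) d
    gcongr
  have hsub : Finset.Ico r (2 * r) ⊆ Finset.range m := fun s hs => by
    rw [Finset.mem_Ico] at hs
    rw [Finset.mem_range]
    omega
  calc 1 / (16 ^ (3 * d + 1) * (d.factorial : ℝ) ^ 3) * (m : ℝ) ^ (3 * d + 1)
      = ((m : ℝ) / 16) ^ (3 * d + 1) / (d.factorial : ℝ) ^ 3 := by
        rw [div_pow]; field_simp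
    _ ≤ (r : ℝ) ^ (3 * d + 1) / (d.factorial : ℝ) ^ 3 := by gcongr
    _ = (Finset.Ico r (2 * r)).card •
          (((r : ℝ) ^ d / (d.factorial : ℝ)) ^ 2 * ((r : ℝ) ^ d / (d.factorial : ℝ))) := by
        rw [Nat.card_Ico, show 2 * r - r = r by omega, nsmul_eq_mul]; ring
    _ ≤ _ := Finset.card_nsmul_le_sum _ _ _ le_term
    _ ≤ combH (d + 1) m := by
        refine Finset.sum_le_sum_of_subset_of_nonneg hsub fun s _ _ => ?_
        split_ifs <;> positivity

/-- for `k ≥ 2`, the function `H` grows exactly of degree `3k − 2` along the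
even integers. -/
theorem combH_growth (k : ℕ) (hk : 2 ≤ k) :
    ∃ c₁ c₂ : ℝ, 0 < c₁ ∧ 0 < c₂ ∧ ∃ N : ℕ, ∀ m : ℕ, N ≤ m → Even m →
      c₁ * (m : ℝ) ^ (3 * k - 2) ≤ combH k m ∧
      combH k m ≤ c₂ * (m : ℝ) ^ (3 * k - 2) := by
  obtain ⟨d, rfl⟩ : ∃ d, k = d + 1 := ⟨k - 1, by omega⟩
  rw [show 3 * (d + 1) - 2 = 3 * d + 1 by omega]
  exact ⟨1 / (16 ^ (3 * d + 1) * (d.factorial : ℝ) ^ 3), 2 ^ (3 * d), by positivity,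
    by positivity, d + 8, fun m hm _ => ⟨le_combH d m (by omega), combH_le d m (by omega)⟩⟩
end
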